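/- Let Q₁ be the positive definite integral quadratic form in 16 variables given by the orthogonal direct sum E_8 ⊞ E_8 of two copies of E_8(x) := (∑_{1≤i≤j≤8} x_i x_j) − x_1x_2 − x_2x_3, and let Q₂ be the quadratic form of the lattice D₁₆⁺ := D₁₆ + ℤ·v ⊂ ℚ¹⁶, where D₁₆ = {x ∈ ℤ¹⁶ : ∑ x_i ≡ 0 (mod 2)}, v = (1/2)(1,…,1), and the quadratic form on ℚ¹⁶ is Q(x) = (1/2)∑_{i=1}^{16} x_i². Then Q₁ and Q₂ have the same representation numbers, i.e. for every integer m ≥ 0 the number of x ∈ ℤ¹⁶ with Q₁(x) = m equals the number of lattice vectors w ∈ D₁₆⁺ with Q(w) = m, yet Q₁ and Q₂ are not GL_16(ℤ)-equivalent. -/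

import Mathlib

open scoped BigOperators

/-- Mordell's form `E₈(x) = (∑_{1 ≤ i ≤ j ≤ 8} x_i x_j) - x₁x₂ - x₂x₃`. -/
def E8form (x : Fin 8 → ℤ) : ℤ :=
  (∑ i, ∑ j, if i ≤ j then x i * x j else 0) - x 0 * x 1 - x 1 * x 2

/-- The orthogonal direct sum `Q₁ = E₈ ⊞ E₈`, a positive definite integral quadratic
form in `16` variables of discriminant `1`. -/
def Q1 (x : Fin 16 → ℤ) : ℤ :=
  E8form (fun i => x (Fin.castAdd 8 i)) + E8form (fun i => x (Fin.natAdd 8 i))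

/-- The quadratic form `Q(x) = (1/2) ∑_{i=1}^{16} x_i²` on `ℚ¹⁶`. -/
def q16 (w : Fin 16 → ℚ) : ℚ := (1 / 2) * ∑ i, (w i) ^ 2

/-- The lattice `D₁₆ = {x ∈ ℤ¹⁶ : ∑ x_i ≡ 0 (mod 2)}`, viewed inside `ℚ¹⁶`. -/
def D16set : Set (Fin 16 → ℚ) :=
  {w | ∃ x : Fin 16 → ℤ, Even (∑ i, x i) ∧ ∀ i, w i = (x i : ℚ)}

/-- The glue vector `v = (1/2)(1, …, 1)`. -/
def vhalf : Fin 16 → ℚ := fun _ => 1 / 2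

/-- The lattice `D₁₆⁺ = D₁₆ + ℤ·v ⊂ ℚ¹⁶`. -/
noncomputable def D16plus : Submodule ℤ (Fin 16 → ℚ) :=
  Submodule.span ℤ (insert vhalf D16set)

/-- Class `a` of the quotient `D₄* / D₄` (in doubled coordinates). -/
def K (a : Fin 4) (y : Fin 4 → ℤ) : Prop :=
  (∀ i, y i % 2 = ((a.val / 2 : ℕ) : ℤ)) ∧ (∑ i, y i) % 4 = ((2 * (a.val % 2) : ℕ) : ℤ)

/-- Involutive isometries of `D₄*` exchanging class `1` and class `a`. -/
def T (a : Fin 4) (y : Fin 4 → ℤ) : Fin 4 → ℤ :=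
  if a = 2 then
    ![y 0 - (y 0 + y 1 + y 2 - y 3) / 2, y 1 - (y 0 + y 1 + y 2 - y 3) / 2,
      y 2 - (y 0 + y 1 + y 2 - y 3) / 2, y 3 + (y 0 + y 1 + y 2 - y 3) / 2]
  else if a = 3 then
    ![y 0 - (y 0 + y 1 + y 2 + y 3) / 2, y 1 - (y 0 + y 1 + y 2 + y 3) / 2,
      y 2 - (y 0 + y 1 + y 2 + y 3) / 2, y 3 - (y 0 + y 1 + y 2 + y 3) / 2]
  else y

def can (a : Fin 4) : Fin 4 := if a = 0 then 0 else 1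

lemma K_unique {a b : Fin 4} {y : Fin 4 → ℤ} (ha : K a y) (hb : K b y) : a = b := by
  have h1 := ha.1 0
  have h2 := hb.1 0
  have h3 := ha.2
  have h4 := hb.2
  ext
  omega

lemma K_iff (a : Fin 4) (y : Fin 4 → ℤ) : K a y ↔
    (y 0 % 2 = ((a.val / 2 : ℕ) : ℤ) ∧ y 1 % 2 = ((a.val / 2 : ℕ) : ℤ) ∧
     y 2 % 2 = ((a.val / 2 : ℕ) : ℤ) ∧ y 3 % 2 = ((a.val / 2 : ℕ) : ℤ)) ∧
     (y 0 + y 1 + y 2 + y 3) % 4 = ((2 * (a.val % 2) : ℕ) : ℤ) := by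
  simp only [K, Fin.forall_fin_succ, Fin.sum_univ_four]
  simp

lemma T_class {a : Fin 4} {y : Fin 4 → ℤ} (h : K a y) : K (can a) (T a y) := by
  rw [K_iff] at *
  fin_cases a <;> simp [can, T] at * <;> omega

lemma T_class' {a : Fin 4} {y : Fin 4 → ℤ} (h : K (can a) y) : K a (T a y) := by
  rw [K_iff] at *
  fin_cases a <;> simp [can, T] at * <;> omega

lemma T_invol (a : Fin 4) (y : Fin 4 → ℤ) (h : ∃ b, K b y) : T a (T a y) = y := by
  obtain ⟨b, h⟩ := h
  rw [K_iff] at h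
  fin_cases a <;> simp [T] <;> ext i <;> fin_cases i <;> simp <;> omega

lemma T_norm (a : Fin 4) (y : Fin 4 → ℤ) (h : ∃ b, K b y) :
    ∑ i, (T a y i) ^ 2 = ∑ i, (y i) ^ 2 := by
  obtain ⟨b, h⟩ := h
  rw [K_iff] at h
  rw [Fin.sum_univ_four, Fin.sum_univ_four]
  unfold T
  split_ifs
  · obtain ⟨k, hk⟩ : ∃ k, k = (y 0 + y 1 + y 2 - y 3) / 2 := ⟨_, rfl⟩
    have h3 : y 3 = y 0 + y 1 + y 2 - 2 * k := by omega
    rw [← hk]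
    simp
    rw [h3]; ring
  · obtain ⟨k, hk⟩ : ∃ k, k = (y 0 + y 1 + y 2 + y 3) / 2 := ⟨_, rfl⟩
    have h3 : y 3 = 2 * k - (y 0 + y 1 + y 2) := by omega
    rw [← hk]
    simp
    rw [h3]; ring
  · rfl

abbrev Fib (n : ℤ) (w : Fin 4 → Fin 4) : Type :=
  {y : Fin 4 → Fin 4 → ℤ // (∀ i, K (w i) (y i)) ∧ ∑ i, ∑ j, (y i j) ^ 2 = n}

def fibCan (n : ℤ) (w : Fin 4 → Fin 4) : Fib n w ≃ Fib n (fun i => can (w i)) where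
  toFun y := ⟨fun i => T (w i) (y.1 i), fun i => T_class (y.2.1 i), by
    refine Eq.trans ?_ y.2.2
    exact Finset.sum_congr rfl fun i _ => T_norm _ _ ⟨_, y.2.1 i⟩⟩
  invFun y := ⟨fun i => T (w i) (y.1 i), fun i => T_class' (y.2.1 i), by
    refine Eq.trans ?_ y.2.2
    exact Finset.sum_congr rfl fun i _ => T_norm _ _ ⟨_, y.2.1 i⟩⟩
  left_inv y := Subtype.ext (funext fun i => T_invol _ _ ⟨_, y.2.1 i⟩)
  right_inv y := Subtype.ext (funext fun i => T_invol _ _ ⟨_, y.2.1 i⟩)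

def fibPerm (n : ℤ) (w : Fin 4 → Fin 4) (π : Equiv.Perm (Fin 4)) :
    Fib n w ≃ Fib n (fun i => w (π i)) where
  toFun y := ⟨fun i => y.1 (π i), fun i => y.2.1 (π i), by
    refine Eq.trans ?_ y.2.2
    exact Equiv.sum_comp π fun i => ∑ j, (y.1 i j) ^ 2⟩
  invFun y := ⟨fun i => y.1 (π.symm i), fun i => by simpa using y.2.1 (π.symm i), by
    refine Eq.trans ?_ y.2.2
    exact Equiv.sum_comp π.symm fun i => ∑ j, (y.1 i j) ^ 2⟩
  left_inv y := Subtype.ext (by simp)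
  right_inv y := Subtype.ext (by simp)

/-- Glue words of `E₈ ⊞ E₈` over `D₄⁴`. -/
def c1 (p : Fin 4 × Fin 4) : Fin 4 → Fin 4 := ![p.1, p.1, p.2, p.2]

/-- Glue words of `D₁₆⁺` over `D₄⁴`. -/
def c2 (p : Fin 4 × Fin 4) : Fin 4 → Fin 4 :=
  (![![![0,0,0,0], ![0,0,1,1], ![0,1,0,1], ![0,1,1,0]],
     ![![1,1,0,0], ![1,1,1,1], ![2,2,2,2], ![3,3,3,3]],
     ![![1,0,1,0], ![2,2,3,3], ![3,3,2,2], ![2,3,2,3]],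
     ![![1,0,0,1], ![3,2,3,2], ![2,3,3,2], ![3,2,2,3]]] :
    Fin 4 → Fin 4 → Fin 4 → Fin 4) p.1 p.2

lemma c1_inj : Function.Injective c1 := by unfold Function.Injective; decide

lemma c2_inj : Function.Injective c2 := by unfold Function.Injective; decide

set_option maxRecDepth 100000 in
lemma c12 : ∀ p, ∃ π : Equiv.Perm (Fin 4), ∀ i, can (c1 p (π i)) = can (c2 p i) := by
  decide

set_option maxRecDepth 100000 in
lemma c2_surj : ∀ a b c d : Fin 4, a.val / 2 = b.val / 2 → a.val / 2 = c.val / 2 →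
    a.val / 2 = d.val / 2 → (a.val + b.val + c.val + d.val) % 2 = 0 →
    ∃ p, c2 p = ![a, b, c, d] := by
  decide

set_option maxRecDepth 100000 in
lemma c2_prop : ∀ p, (c2 p 0).val / 2 = (c2 p 1).val / 2 ∧ (c2 p 0).val / 2 = (c2 p 2).val / 2 ∧
    (c2 p 0).val / 2 = (c2 p 3).val / 2 ∧
    ((c2 p 0).val + (c2 p 1).val + (c2 p 2).val + (c2 p 3).val) % 2 = 0 := by
  decide

lemma fib12 (n : ℤ) (p) : Nonempty (Fib n (c1 p) ≃ Fib n (c2 p)) := by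
  obtain ⟨π, h⟩ := c12 p
  have e : Fib n (fun i => can (c1 p (π i))) ≃ Fib n (fun i => can (c2 p i)) := by
    rw [funext h]
  exact ⟨(fibPerm n _ π).trans ((fibCan n _).trans (e.trans (fibCan n _).symm))⟩

/-- Lattice vectors of the gluing of `D₄⁴` along `c`, of norm `n`. -/
abbrev GLat (c : Fin 4 × Fin 4 → Fin 4 → Fin 4) (n : ℤ) : Type :=
  {y : Fin 4 → Fin 4 → ℤ // (∃ p, ∀ i, K (c p i) (y i)) ∧ ∑ i, ∑ j, (y i j) ^ 2 = n}

noncomputable def latEquiv (c) (hc : Function.Injective c) (n : ℤ) :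
    (Σ p, Fib n (c p)) ≃ GLat c n :=
  Equiv.ofBijective (fun s => ⟨s.2.1, ⟨s.1, s.2.2.1⟩, s.2.2.2⟩) (by
    constructor
    · rintro ⟨p, y⟩ ⟨p', y'⟩ h
      have h1 : y.1 = y'.1 := congrArg Subtype.val h
      have h2 : p = p' := hc (funext fun i => K_unique (y.2.1 i) (h1 ▸ y'.2.1 i))
      subst h2
      have : y = y' := Subtype.ext h1
      rw [this]
    · rintro ⟨y, ⟨p, hp⟩, hn⟩
      exact ⟨⟨p, y, hp, hn⟩, rfl⟩)

lemma lat12 (n : ℤ) : Nonempty (GLat c1 n ≃ GLat c2 n) :=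
  ⟨(latEquiv c1 c1_inj n).symm.trans
    ((Equiv.sigmaCongrRight fun p => (fib12 n p).some).trans (latEquiv c2 c2_inj n))⟩

def eA (x : Fin 8 → ℤ) : Fin 4 → ℤ :=
  ![2 * x 0 + 2 * x 1 + x 2 + 2 * (x 3 + x 4 + x 5 + x 6 + x 7), 2 * x 0 - 2 * x 1 + x 2,
    x 2 + 2 * x 3, x 2 + 2 * x 4]

def eB (x : Fin 8 → ℤ) : Fin 4 → ℤ :=
  ![x 2 + 2 * x 5, x 2 + 2 * x 6, x 2 + 2 * x 7, x 2]

lemma e_class (x : Fin 8 → ℤ) : ∃ a, K a (eA x) ∧ K a (eB x) := by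
  have h : (x 2 % 2 = 0 ∨ x 2 % 2 = 1) := by omega
  have h' : ((x 2 + x 2 + x 2 + x 2 + 2 * (x 5 + x 6 + x 7)) % 4 = 0 ∨
    (x 2 + x 2 + x 2 + x 2 + 2 * (x 5 + x 6 + x 7)) % 4 = 2) := by omega
  simp only [K_iff]
  rcases h with h | h <;> rcases h' with h' | h'
  · refine ⟨0, ?_⟩
    simp [eA, eB]; omega
  · refine ⟨1, ?_⟩
    simp [eA, eB]; omega
  · refine ⟨2, ?_⟩
    simp [eA, eB]; omega
  · refine ⟨3, ?_⟩
    simp [eA, eB]; omega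

lemma e_norm (x : Fin 8 → ℤ) :
    ∑ i, (eA x i) ^ 2 + ∑ i, (eB x i) ^ 2 = 8 * E8form x := by
  simp only [E8form, Fin.sum_univ_eight, Fin.sum_univ_four]
  simp [eA, eB, Fin.le_def]
  ring

lemma e_inj (x x' : Fin 8 → ℤ) (hA : eA x = eA x') (hB : eB x = eB x') : x = x' := by
  have a0 := congrFun hA 0
  have a1 := congrFun hA 1
  have a2 := congrFun hA 2
  have a3 := congrFun hA 3
  have b0 := congrFun hB 0
  have b1 := congrFun hB 1
  have b2 := congrFun hB 2
  have b3 := congrFun hB 3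
  simp [eA, eB] at a0 a1 a2 a3 b0 b1 b2 b3
  ext i
  fin_cases i <;> simp <;> omega

lemma e_surj (a : Fin 4) (u v : Fin 4 → ℤ) (hu : K a u) (hv : K a v) :
    ∃ x, eA x = u ∧ eB x = v := by
  rw [K_iff] at hu hv
  refine ⟨![(u 0 + u 1 - u 2 - u 3 - v 0 - v 1 - v 2 + 3 * v 3) / 4,
    (u 0 - u 1 - u 2 - u 3 - v 0 - v 1 - v 2 + 5 * v 3) / 4, v 3,
    (u 2 - v 3) / 2, (u 3 - v 3) / 2, (v 0 - v 3) / 2, (v 1 - v 3) / 2, (v 2 - v 3) / 2], ?_, ?_⟩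
  · ext i
    fin_cases i <;> simp [eA] <;> omega
  · ext i
    fin_cases i <;> simp [eB] <;> omega

def lo (x : Fin 16 → ℤ) : Fin 8 → ℤ := fun i => x (Fin.castAdd 8 i)
def hi (x : Fin 16 → ℤ) : Fin 8 → ℤ := fun i => x (Fin.natAdd 8 i)

lemma card1 (m : ℕ) : Nonempty ({x : Fin 16 → ℤ // Q1 x = (m : ℤ)} ≃ GLat c1 (8 * m)) := by
  refine ⟨Equiv.ofBijective
    (fun x => ⟨![eA (lo x.1), eB (lo x.1), eA (hi x.1), eB (hi x.1)], ?_, ?_⟩) ⟨?_, ?_⟩⟩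
  · obtain ⟨a, ha⟩ := e_class (lo x.1)
    obtain ⟨b, hb⟩ := e_class (hi x.1)
    refine ⟨(a, b), fun i => ?_⟩
    fin_cases i
    exacts [ha.1, ha.2, hb.1, hb.2]
  · have h := x.2
    have h1 := e_norm (lo x.1)
    have h2 := e_norm (hi x.1)
    have h3 : Q1 x.1 = E8form (lo x.1) + E8form (hi x.1) := rfl
    rw [Fin.sum_univ_four]
    simp only [Matrix.cons_val]
    linarith
  · intro x x' h
    have h := congrArg Subtype.val h
    have h0 := e_inj _ _ (congrFun h 0) (congrFun h 1)
    have h1 := e_inj _ _ (congrFun h 2) (congrFun h 3)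
    refine Subtype.ext (funext fun i => ?_)
    refine Fin.addCases (m := 8) (n := 8) (fun i => ?_) (fun i => ?_) i
    · exact congrFun h0 i
    · exact congrFun h1 i
  · rintro ⟨y, ⟨p, hp⟩, hn⟩
    obtain ⟨x, hx, hx'⟩ := e_surj p.1 (y 0) (y 1) (hp 0) (hp 1)
    obtain ⟨z, hz, hz'⟩ := e_surj p.2 (y 2) (y 3) (hp 2) (hp 3)
    have hlo : lo (Fin.append x z) = x := by ext i; exact Fin.append_left x z i
    have hhi : hi (Fin.append x z) = z := by ext i; exact Fin.append_right x z i
    refine ⟨⟨Fin.append x z, ?_⟩, ?_⟩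
    · have h1 := e_norm x
      have h2 := e_norm z
      have h3 : Q1 (Fin.append x z) = E8form (lo (Fin.append x z)) + E8form (hi (Fin.append x z)) :=
        rfl
      rw [hlo, hhi] at h3
      rw [Fin.sum_univ_four] at hn
      rw [hx, hx'] at h1
      rw [hz, hz'] at h2
      linarith
    · refine Subtype.ext ?_
      simp only [hlo, hhi, hx, hx', hz, hz']
      ext i
      fin_cases i <;> rfl

/-- Doubled-coordinate description of `D₁₆⁺`. -/
lemma mem_D16plus (w : Fin 16 → ℚ) : w ∈ D16plus ↔
    ∃ y : Fin 16 → ℤ, (∀ i, y i % 2 = y 0 % 2) ∧ (∑ i, y i) % 4 = 0 ∧ ∀ i, w i = (y i : ℚ) / 2 := by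
  constructor
  · intro h
    induction h using Submodule.span_induction with
    | mem x hx =>
      rcases hx with rfl | ⟨z, hz, hz'⟩
      · exact ⟨fun _ => 1, by simp, by simp, by simp [vhalf]⟩
      · refine ⟨fun i => 2 * z i, by simp, ?_, ?_⟩
        · rw [← Finset.mul_sum]
          obtain ⟨k, hk⟩ := hz
          omega
        · intro i; rw [hz']; push_cast; ring
    | zero => exact ⟨0, by simp, by simp, by simp⟩
    | add a b _ _ ha hb =>
      obtain ⟨y, h1, h2, h3⟩ := ha
      obtain ⟨z, k1, k2, k3⟩ := hb
      refine ⟨fun i => y i + z i, fun i => ?_, ?_, fun i => ?_⟩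
      · have := h1 i; have := k1 i; simp only; omega
      · rw [Finset.sum_add_distrib]; omega
      · rw [Pi.add_apply, h3, k3]; push_cast; ring
    | smul r a _ ha =>
      obtain ⟨y, h1, h2, h3⟩ := ha
      refine ⟨fun i => r * y i, fun i => ?_, ?_, fun i => ?_⟩
      · exact Int.ModEq.mul_left r (h1 i)
      · rw [← Finset.mul_sum]
        exact Int.emod_eq_zero_of_dvd (Dvd.dvd.mul_left (Int.dvd_of_emod_eq_zero h2) r)
      · rw [Pi.smul_apply, h3]; simp; ring
  · rintro ⟨y, h1, h2, h3⟩
    obtain ⟨z, hz⟩ : ∃ z : Fin 16 → ℤ, ∀ i, y i = 2 * z i + y 0 % 2 :=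
      ⟨fun i => y i / 2, fun i => by have := h1 i; simp only; omega⟩
    have hs : ∑ i, y i = 2 * ∑ i, z i + 16 * (y 0 % 2) := by
      rw [Finset.sum_congr rfl fun i _ => hz i, Finset.sum_add_distrib, ← Finset.mul_sum]
      simp
    have hw : w = (fun i => (z i : ℚ)) + (y 0 % 2) • vhalf := by
      ext i
      rw [h3]
      rw [Pi.add_apply, Pi.smul_apply, zsmul_eq_mul]
      simp only [vhalf]
      have : (y i : ℚ) = 2 * z i + ((y 0 % 2 : ℤ) : ℚ) := by exact_mod_cast hz i
      rw [this]; ring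
    rw [hw]
    refine Submodule.add_mem _ (Submodule.subset_span (Or.inr ⟨z, ?_, fun _ => rfl⟩))
      (Submodule.smul_mem _ _ (Submodule.subset_span (Or.inl rfl)))
    rw [Int.even_iff]; omega

/-- Index `4 i + j`. -/
def ix : Fin 4 × Fin 4 ≃ Fin 16 := finProdFinEquiv

lemma sum_ix {M : Type} [AddCommMonoid M] (f : Fin 16 → M) :
    ∑ i, f i = ∑ i, ∑ j, f (ix (i, j)) := by
  rw [← Equiv.sum_comp ix, Fintype.sum_prod_type]

lemma K_exists (y : Fin 4 → ℤ) (r : ℤ) (hr : r = 0 ∨ r = 1) (h : ∀ i, y i % 2 = r) :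
    ∃ a, K a y := by
  simp only [K_iff]
  have h0 := h 0
  have h1 := h 1
  have h2 := h 2
  have h3 := h 3
  have h' : (y 0 + y 1 + y 2 + y 3) % 4 = 0 ∨ (y 0 + y 1 + y 2 + y 3) % 4 = 2 := by omega
  rcases hr with rfl | rfl <;> rcases h' with h' | h'
  · exact ⟨0, by simp; omega⟩
  · exact ⟨1, by simp; omega⟩
  · exact ⟨2, by simp; omega⟩
  · exact ⟨3, by simp; omega⟩

lemma card2 (m : ℕ) :
    Nonempty (GLat c2 (8 * m) ≃ {w : Fin 16 → ℚ // w ∈ D16plus ∧ q16 w = (m : ℚ)}) := by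
  refine ⟨Equiv.ofBijective
    (fun y => ⟨fun k => (y.1 (ix.symm k).1 (ix.symm k).2 : ℚ) / 2, ?_, ?_⟩) ⟨?_, ?_⟩⟩
  · obtain ⟨y, ⟨p, hp⟩, hn⟩ := y
    rw [mem_D16plus]
    refine ⟨fun k => y (ix.symm k).1 (ix.symm k).2, ?_, ?_, fun i => rfl⟩
    · have key : ∀ i j, y i j % 2 = (((c2 p 0).val / 2 : ℕ) : ℤ) := by
        intro i j
        rw [(hp i).1 j]
        obtain ⟨h1, h2, h3, -⟩ := c2_prop p
        fin_cases i
        · rfl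
        · rw [h1]; rfl
        · rw [h2]; rfl
        · rw [h3]; rfl
      intro i
      simp only [key]
    · rw [sum_ix]
      simp only [Equiv.symm_apply_apply]
      rw [Fin.sum_univ_four]
      have h0 := (hp 0).2
      have h1 := (hp 1).2
      have h2 := (hp 2).2
      have h3 := (hp 3).2
      obtain ⟨-, -, -, h4⟩ := c2_prop p
      omega
  · obtain ⟨y, ⟨p, hp⟩, hn⟩ := y
    have hn' : ∑ i, ∑ j, (y i j : ℚ) ^ 2 = 8 * m := by exact_mod_cast hn
    unfold q16
    rw [sum_ix]
    simp only [Equiv.symm_apply_apply, div_pow, ← Finset.sum_div]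
    rw [hn']; ring
  · intro y y' h
    have h := congrArg Subtype.val h
    refine Subtype.ext (funext fun i => funext fun j => ?_)
    have := congrFun h (ix (i, j))
    simp only [Equiv.symm_apply_apply] at this
    have h2 : (y.1 i j : ℚ) = y'.1 i j := by linarith
    exact_mod_cast h2
  · rintro ⟨w, hw, hq⟩
    obtain ⟨z, h1, h2, h3⟩ := (mem_D16plus w).1 hw
    have hr : z 0 % 2 = 0 ∨ z 0 % 2 = 1 := by omega
    have hK : ∀ i, ∃ a, K a (fun j => z (ix (i, j))) := fun i =>
      K_exists _ _ hr (fun j => h1 _)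
    choose a ha using hK
    refine ⟨⟨fun i j => z (ix (i, j)), ?_, ?_⟩, ?_⟩
    · obtain ⟨p, hp⟩ : ∃ p, c2 p = ![a 0, a 1, a 2, a 3] := by
        rw [sum_ix, Fin.sum_univ_four] at h2
        have e0 : (∑ j, z (ix (0, j))) % 4 = _ := (ha 0).2
        have e1 : (∑ j, z (ix (1, j))) % 4 = _ := (ha 1).2
        have e2 : (∑ j, z (ix (2, j))) % 4 = _ := (ha 2).2
        have e3 : (∑ j, z (ix (3, j))) % 4 = _ := (ha 3).2
        have f0 := (ha 0).1 0
        have f1 := (ha 1).1 0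
        have f2 := (ha 2).1 0
        have f3 := (ha 3).1 0
        simp only [h1] at f0 f1 f2 f3
        apply c2_surj <;> omega
      refine ⟨p, fun i => ?_⟩
      rw [hp]
      fin_cases i
      exacts [ha 0, ha 1, ha 2, ha 3]
    · unfold q16 at hq
      rw [sum_ix] at hq
      simp only [h3, div_pow, ← Finset.sum_div] at hq
      have : ∑ i, ∑ j, (z (ix (i, j)) : ℚ) ^ 2 = 8 * m := by linarith
      exact_mod_cast this
    · refine Subtype.ext (funext fun k => ?_)
      simp [h3]

lemma root_int (w : Fin 16 → ℚ) (hw : w ∈ D16plus) (h : q16 w = 1) :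
    ∃ z : ℤ, w 0 = z := by
  obtain ⟨y, h1, h2, h3⟩ := (mem_D16plus w).1 hw
  have hn : ∑ i, (y i) ^ 2 = 8 := by
    unfold q16 at h
    simp only [h3, div_pow, ← Finset.sum_div] at h
    have : ∑ i, (y i : ℚ) ^ 2 = 8 := by linarith
    exact_mod_cast this
  rcases Int.even_or_odd (y 0) with ⟨k, hk⟩ | ⟨k, hk⟩
  · exact ⟨k, by rw [h3, hk]; push_cast; ring⟩
  · exfalso
    have : ∀ i ∈ Finset.univ, (1 : ℤ) ≤ (y i) ^ 2 := by
      intro i _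
      have := h1 i
      have hne : y i ≠ 0 := by omega
      have := sq_pos_of_ne_zero hne
      omega
    have := Finset.sum_le_sum this
    simp at this
    omega

lemma Q1_single (j : Fin 16) : Q1 (Pi.single j 1) = 1 := by
  revert j; decide

lemma noneq (e : Fin 16 → (Fin 16 → ℚ)) (he : Submodule.span ℤ (Set.range e) = D16plus)
    (g : GL (Fin 16) ℤ)
    (hg : ∀ c : Fin 16 → ℤ, q16 (∑ i, (c i : ℚ) • e i) =
      ((Q1 (Matrix.mulVec (↑(g⁻¹) : Matrix (Fin 16) (Fin 16) ℤ) c) : ℤ) : ℚ)) : False := by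
  -- the linear map `c ↦ ∑ cᵢ eᵢ`
  let L : (Fin 16 → ℤ) →ₗ[ℤ] (Fin 16 → ℚ) := Fintype.linearCombination ℤ e
  have hL : ∀ c, L c = ∑ i, (c i : ℚ) • e i := by
    intro c
    simp only [L, Fintype.linearCombination_apply, Int.cast_smul_eq_zsmul]
  have hmem : ∀ c, L c ∈ D16plus := by
    intro c
    rw [← he, ← Fintype.range_linearCombination]
    exact ⟨c, rfl⟩
  have hroot : ∀ j, ∃ z : ℤ, L (Matrix.mulVec (g : Matrix (Fin 16) (Fin 16) ℤ) (Pi.single j 1)) 0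
      = z := by
    intro j
    apply root_int _ (hmem _)
    rw [hL, hg, Matrix.mulVec_mulVec, ← Units.val_mul, inv_mul_cancel, Units.val_one,
      Matrix.one_mulVec, Q1_single]
    simp
  choose z hz using hroot
  have hv : vhalf ∈ Submodule.span ℤ (Set.range e) := by
    rw [he]; exact Submodule.subset_span (Or.inl rfl)
  rw [← Fintype.range_linearCombination] at hv
  obtain ⟨c, hc⟩ := hv
  change L c = vhalf at hc
  set d := Matrix.mulVec (↑(g⁻¹) : Matrix (Fin 16) (Fin 16) ℤ) c with hd
  have hcd : c = Matrix.mulVec (g : Matrix (Fin 16) (Fin 16) ℤ) d := by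
    rw [hd, Matrix.mulVec_mulVec, ← Units.val_mul, mul_inv_cancel, Units.val_one,
      Matrix.one_mulVec]
  have hd' : d = ∑ j, d j • (Pi.single j 1 : Fin 16 → ℤ) := by
    ext i; simp [Finset.sum_apply, Pi.single_apply]
  have h0 : L c 0 = ((∑ j, d j * z j : ℤ) : ℚ) := by
    conv_lhs => rw [hcd, hd', Matrix.mulVec_sum, map_sum, Finset.sum_apply]
    push_cast
    refine Finset.sum_congr rfl fun j _ => ?_
    rw [Matrix.mulVec_smul, map_smul, Pi.smul_apply, hz]
    simp
  rw [hc] at h0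
  have h1 : ((1 : ℤ) : ℚ) = ((2 * ∑ j, d j * z j : ℤ) : ℚ) := by
    rw [Int.cast_mul, ← h0]; norm_num [vhalf]
  have h2 : (1 : ℤ) = 2 * ∑ j, d j * z j := by exact_mod_cast h1
  omega

/-- Witt, Milnor: the forms `E₈ ⊞ E₈` and `D₁₆⁺` have the same
representation numbers, but they are not `GL₁₆(ℤ)`-equivalent (for any choice of ℤ-basis
of `D₁₆⁺`, the resulting integral form is inequivalent to `E₈ ⊞ E₈`). -/
theorem E8E8_D16plus_same_representation_numbers_not_equivalent :
    (∀ m : ℕ,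
      Nat.card {x : Fin 16 → ℤ // Q1 x = (m : ℤ)} =
        Nat.card {w : Fin 16 → ℚ // w ∈ D16plus ∧ q16 w = (m : ℚ)}) ∧
    (∀ e : Fin 16 → (Fin 16 → ℚ), Submodule.span ℤ (Set.range e) = D16plus →
      ¬ ∃ g : GL (Fin 16) ℤ, ∀ c : Fin 16 → ℤ,
        q16 (∑ i, (c i : ℚ) • e i) =
          ((Q1 (Matrix.mulVec (↑(g⁻¹) : Matrix (Fin 16) (Fin 16) ℤ) c) : ℤ) : ℚ)) := by
  refine ⟨fun m => ?_, fun e he ⟨g, hg⟩ => noneq e he g hg⟩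
  exact Nat.card_congr ((card1 m).some.trans ((lat12 _).some.trans (card2 m).some))
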